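/- Let dim V = 5 and let H be a hyperplane of the 3-Grassmannian of V, defined by a nontrivial alternating 3-linear form φ. Then the upper radical R^↑(H) is nonempty: there exists a 2-dimensional subspace A of V such that φ(a₁, a₂, x) = 0 for a basis a₁, a₂ of A and all x ∈ V. -/

import Mathlib

open Module

namespace AlternatingMap

variable {K V : Type*} [Field K] [AddCommGroup V] [Module K V]

theorem map_vec3_swap_left (φ : AlternatingMap K V K (Fin 3)) (x y z : V) :
    φ ![y, x, z] = -φ ![x, y, z] := by
  rw [← φ.map_swap ![x, y, z] (i := 0) (j := 1) (by decide)]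
  congr 1
  ext i
  fin_cases i <;> rfl

theorem map_vec3_swap_right (φ : AlternatingMap K V K (Fin 3)) (x y z : V) :
    φ ![x, z, y] = -φ ![x, y, z] := by
  rw [← φ.map_swap ![x, y, z] (i := 1) (j := 2) (by decide)]
  congr 1
  ext i
  fin_cases i <;> rfl

theorem map_vec3_self_left (φ : AlternatingMap K V K (Fin 3)) (x y : V) :
    φ ![x, x, y] = 0 :=
  φ.map_eq_zero_of_eq _ (i := 0) (j := 1) rfl (by decide)

theorem map_vec3_self_right (φ : AlternatingMap K V K (Fin 3)) (x y : V) :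
    φ ![x, y, y] = 0 :=
  φ.map_eq_zero_of_eq _ (i := 1) (j := 2) rfl (by decide)

/-- The bilinear form obtained from an alternating 3-form by fixing its first argument. -/
def contract (φ : AlternatingMap K V K (Fin 3)) (u : V) : V →ₗ[K] V →ₗ[K] K :=
  LinearMap.mk₂ K (fun w x => φ ![u, w, x])
    (fun w w' x => by
      simp only [φ.map_vec3_swap_left _ u, map_vecCons_add, neg_add])
    (fun c w x => by
      simp only [φ.map_vec3_swap_left _ u, map_vecCons_smul, smul_neg])
    (fun w x x' => by
      simp only [φ.map_vec3_swap_right u _ w, φ.map_vec3_swap_left _ u, map_vecCons_add, neg_add])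
    (fun c w x => by
      simp only [φ.map_vec3_swap_right u _ w, φ.map_vec3_swap_left _ u, map_vecCons_smul,
        smul_neg])

@[simp]
theorem contract_apply (φ : AlternatingMap K V K (Fin 3)) (u w x : V) :
    φ.contract u w x = φ ![u, w, x] :=
  rfl

/-- An alternating 3-form is degenerate on the span of four linearly independent vectors. -/
theorem exists_ne_zero_map_vec3_eq_zero (φ : AlternatingMap K V K (Fin 3)) {b : Fin 4 → V}
    (hb : LinearIndependent K b) :
    ∃ u ≠ 0, ∀ i j, φ ![u, b i, b j] = 0 := by
  by_cases h : φ ![b 1, b 2, b 3] = 0 ∧ φ ![b 0, b 2, b 3] = 0 ∧ φ ![b 0, b 1, b 3] = 0 ∧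
      φ ![b 0, b 1, b 2] = 0
  · obtain ⟨-, h₁, h₂, h₃⟩ := h
    refine ⟨b 0, hb.ne_zero 0, fun i j => ?_⟩
    fin_cases i <;> fin_cases j <;>
      simp [map_vec3_self_left, map_vec3_self_right, φ.map_vec3_swap_right _ (b 0) (b 1),
        φ.map_vec3_swap_right _ (b 0) (b 2), φ.map_vec3_swap_right _ (b 0) (b 3),
        φ.map_vec3_swap_right _ (b 1) (b 2), φ.map_vec3_swap_right _ (b 1) (b 3),
        φ.map_vec3_swap_right _ (b 2) (b 3), h₁, h₂, h₃]
  · set c : Fin 4 → K := ![φ ![b 1, b 2, b 3], -φ ![b 0, b 2, b 3], φ ![b 0, b 1, b 3],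
      -φ ![b 0, b 1, b 2]] with hc
    refine ⟨∑ k, c k • b k, fun hu => h ?_, ?_⟩
    · have hz := Fintype.linearIndependent_iff.1 hb c hu
      exact ⟨hz 0, neg_eq_zero.1 (hz 1), hz 2, neg_eq_zero.1 (hz 3)⟩
    · intro i j
      simp only [Fin.sum_univ_four, map_vecCons_add, map_vecCons_smul, hc]
      fin_cases i <;> fin_cases j <;>
        simp [map_vec3_self_left, map_vec3_self_right, φ.map_vec3_swap_left (b 0) (b 1),
          φ.map_vec3_swap_left (b 0) (b 2), φ.map_vec3_swap_left (b 0) (b 3),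
          φ.map_vec3_swap_left (b 1) (b 2), φ.map_vec3_swap_left (b 1) (b 3),
          φ.map_vec3_swap_left (b 2) (b 3),
          φ.map_vec3_swap_right _ (b 0) (b 1), φ.map_vec3_swap_right _ (b 0) (b 2),
          φ.map_vec3_swap_right _ (b 0) (b 3),
          φ.map_vec3_swap_right _ (b 1) (b 2), φ.map_vec3_swap_right _ (b 1) (b 3),
          φ.map_vec3_swap_right _ (b 2) (b 3)] <;> ring

end AlternatingMap

/-- If `dim V = 5` and `φ` is a nontrivial alternating 3-linear form on `V` defining a
hyperplane `H` of the 3-Grassmannian, then the upper radical `R^↑(H)` is nonempty: there exist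
linearly independent `a₁, a₂` (spanning a 2-subspace) with `φ(a₁, a₂, x) = 0` for all `x`. -/
theorem stmt_14 (K V : Type*) [Field K] [AddCommGroup V] [Module K V] [FiniteDimensional K V]
    (hn : finrank K V = 5)
    (φ : AlternatingMap K V K (Fin 3)) (hφ : φ ≠ 0) :
    ∃ a₁ a₂ : V, LinearIndependent K ![a₁, a₂] ∧ ∀ x : V, φ ![a₁, a₂, x] = 0 := by
  let b : Basis (Fin 5) K V := finBasisOfFinrankEq K V hn
  obtain ⟨u, hu, hub⟩ := φ.exists_ne_zero_map_vec3_eq_zero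
    (b.linearIndependent.comp _ (Fin.castSucc_injective 4))
  let L : V →ₗ[K] K × K := (b.coord (Fin.last 4)).prod ((φ.contract u).flip (b (Fin.last 4)))
  obtain ⟨w, hwL, hwu⟩ : ∃ w ∈ LinearMap.ker L, w ∉ K ∙ u := by
    refine SetLike.not_le_iff_exists.1 fun hle => ?_
    have hker := Submodule.finrank_mono hle
    rw [finrank_span_singleton hu] at hker
    have hrange := L.range.finrank_le
    have hsum := L.finrank_range_add_finrank_ker
    rw [finrank_prod, finrank_self] at hrange
    omega
  obtain ⟨hw₁, hw₂⟩ : b.repr w (Fin.last 4) = 0 ∧ φ ![u, w, b (Fin.last 4)] = 0 := by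
    simpa [L] using hwL
  refine ⟨u, w, (LinearIndependent.pair_iff' hu).2 fun a ha =>
    hwu (Submodule.mem_span_singleton.2 ⟨a, ha⟩), fun x => ?_⟩
  suffices φ.contract u w = 0 from LinearMap.congr_fun this x
  refine b.ext fun j => ?_
  induction j using Fin.lastCases with
  | last => exact hw₂
  | cast j =>
    rw [← b.sum_repr w, Fin.sum_univ_castSucc, hw₁]
    have hub' : ∀ i : Fin 4, φ ![u, b i.castSucc, b j.castSucc] = 0 := fun i => hub i j
    simp [hub']
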